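/- In 2×2×3 Abalone, if Black occupies both middle spaces e and f, then either Black has a winning strategy from that constellation (o(C) = L), or the constellation contains the neutral subconfiguration in which Gray marbles on a and b threaten a Black marble on c, in which case the next player to move wins (o(C) = N). -/

import Mathlib

/-- An abstract two-player game with perfect information and alternating moves.
`true` denotes Left (Black) and `false` denotes Right (Gray). -/
structure AGame (P : Type*) where
  /-- `move pl p q` : player `pl` has a legal move from position `p` to position `q`. -/
  move : Bool → P → P → Prop
  /-- `win pl p` : the position `p` is a terminal win for player `pl`. -/
  win : Bool → P → Prop

namespace AGame

variable {P : Type*}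

/-- `FW G pl turn p` : player `pl` can force a win (in finitely many moves)
from position `p` when it is `turn`'s move. -/
inductive FW (G : AGame P) (pl : Bool) : Bool → P → Prop
  | terminal (turn : Bool) (p : P) : G.win pl p → FW G pl turn p
  | self (p q : P) : ¬ G.win (!pl) p → G.move pl p q → FW G pl (!pl) q → FW G pl pl p
  | opp (p : P) : ¬ G.win (!pl) p → (∃ q, G.move (!pl) p q) →
      (∀ q, G.move (!pl) p q → FW G pl pl q) → FW G pl (!pl) p

/-- Outcome class `L` : Left (Black) always wins, whoever moves first. -/
def OutL (G : AGame P) (p : P) : Prop := G.FW true true p ∧ G.FW true false p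

/-- Outcome class `R` : Right (Gray) always wins, whoever moves first. -/
def OutR (G : AGame P) (p : P) : Prop := G.FW false false p ∧ G.FW false true p

/-- Outcome class `N` : whoever moves next wins. -/
def OutN (G : AGame P) (p : P) : Prop := G.FW true true p ∧ G.FW false false p

/-- Outcome class `D` : neither player can force a win (optimal play is an infinite draw). -/
def OutD (G : AGame P) (p : P) : Prop :=
  ¬ G.FW true true p ∧ ¬ G.FW true false p ∧ ¬ G.FW false true p ∧ ¬ G.FW false false p

/-- Outcome class `N̂` : Left wins moving first, and the game is a draw if Right moves first. -/
def OutNhat (G : AGame P) (p : P) : Prop :=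
  G.FW true true p ∧ ¬ G.FW true false p ∧ ¬ G.FW false false p

/-- Outcome class `Ň` : Right wins moving first, and the game is a draw if Left moves first. -/
def OutNcheck (G : AGame P) (p : P) : Prop :=
  G.FW false false p ∧ ¬ G.FW false true p ∧ ¬ G.FW true true p

end AGame

namespace Abalone

/-- A board cell, in axial hexagonal coordinates `(q, r)` where `q` is the column. -/
abbrev Cell : Type := ℤ × ℤ

/-- A constellation: each cell carries a black marble (`some true`),
a gray marble (`some false`), or is empty (`none`). -/
abbrev Pos : Type := Cell → Option Bool

/-- The six unit directions of the hexagonal grid. -/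
def dirs : List Cell := [(1, 0), (0, 1), (-1, 1), (-1, 0), (0, -1), (1, -1)]

/-- Add a direction to a cell. -/
def addc (x d : Cell) : Cell := (x.1 + d.1, x.2 + d.2)

/-- The cell `n` steps from `x` in direction `d`. -/
def stepc (x : Cell) (n : ℕ) (d : Cell) : Cell := (x.1 + (n : ℤ) * d.1, x.2 + (n : ℤ) * d.2)

/-- The opposite direction. -/
def negd (d : Cell) : Cell := (-d.1, -d.2)

open Classical in
/-- The result of shifting the line of `len` marbles starting one step after `x`
(in direction `d`, with the marble at `x` itself moving into the vacated space):
cell `x` is vacated, each cell `x + i·d` (`1 ≤ i ≤ len`) receives the content of its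
predecessor, and marbles shifted off the board are removed. -/
noncomputable def shiftResult (board : Finset Cell) (c : Pos) (x d : Cell) (len : ℕ) : Pos :=
  fun y =>
    if y ∉ board then none
    else if y = x then none
    else if ∃ i : ℕ, 1 ≤ i ∧ i ≤ len ∧ y = stepc x i d then c (addc y (negd d))
    else c y

/-- In-line movement (including sumito pushes): player `pl` moves a line of `k` of their
own contiguous marbles (`1 ≤ k ≤ maxG`) one step in the line's direction `d`, possibly
pushing a strictly shorter opposing line of `m < k` marbles, the leading opposing marble
being pushed either onto an empty board cell or off the board. -/
def InlineMove (board : Finset Cell) (maxG : ℕ) (pl : Bool) (c c' : Pos) : Prop :=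
  ∃ x d, d ∈ dirs ∧ ∃ k m : ℕ,
    1 ≤ k ∧ k ≤ maxG ∧ m < k ∧
    (∀ i < k, stepc x i d ∈ board ∧ c (stepc x i d) = some pl) ∧
    (∀ i, k ≤ i → i < k + m → stepc x i d ∈ board ∧ c (stepc x i d) = some (!pl)) ∧
    ((m = 0 ∧ stepc x k d ∈ board ∧ c (stepc x k d) = none) ∨
      (1 ≤ m ∧ (stepc x (k + m) d ∉ board ∨ c (stepc x (k + m) d) = none))) ∧
    c' = shiftResult board c x d (k + m)

open Classical in
/-- The result of a broadside move: the `k` marbles at `x + i·d` (`i < k`) each move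
one step in direction `e`. -/
noncomputable def broadResult (c : Pos) (pl : Bool) (x d e : Cell) (k : ℕ) : Pos :=
  fun y =>
    if ∃ i < k, y = stepc x i d then none
    else if ∃ i < k, y = addc (stepc x i d) e then some pl
    else c y

/-- Broadside movement: player `pl` moves a line of `k` of their own contiguous marbles
(`1 ≤ k ≤ maxG`, the line in direction `d`) one step in a direction `e` not along the
line, each marble landing on an empty board cell. -/
def BroadsideMove (board : Finset Cell) (maxG : ℕ) (pl : Bool) (c c' : Pos) : Prop :=
  ∃ x d e, d ∈ dirs ∧ e ∈ dirs ∧ e ≠ d ∧ e ≠ negd d ∧ ∃ k : ℕ,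
    1 ≤ k ∧ k ≤ maxG ∧
    (∀ i < k, stepc x i d ∈ board ∧ c (stepc x i d) = some pl) ∧
    (∀ i < k, addc (stepc x i d) e ∈ board ∧ c (addc (stepc x i d) e) = none) ∧
    c' = broadResult c pl x d e k

/-- A legal Abalone move for player `pl`. -/
def Move (board : Finset Cell) (maxG : ℕ) (pl : Bool) (c c' : Pos) : Prop :=
  InlineMove board maxG pl c c' ∨ BroadsideMove board maxG pl c c'

/-- The number of marbles of player `pl` on the board. -/
def countM (board : Finset Cell) (pl : Bool) (c : Pos) : ℕ :=
  (board.filter (fun y => c y = some pl)).card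

/-- Player `pl` has won: the opponent has fewer than `n` marbles left,
i.e. at least one opposing marble has been pushed off the board. -/
def Wins (board : Finset Cell) (n : ℕ) (pl : Bool) (c : Pos) : Prop :=
  countM board (!pl) c < n

/-- The negative of a constellation: swap black and gray marbles. -/
def negP (c : Pos) : Pos := fun y => (c y).map (fun b => !b)

end Abalone

namespace Abalone

/-! ### The 2×2×3 Abalone board

A hexagonal grid of 10 cells with columns of sizes 3, 4, 3, labelled as in the paper:
`a, b, c` the left column (bottom to top), `d, e, f, g` the middle column (bottom to
top, with `e, f` the two central spaces), and `h, i, j` the right column (bottom to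
top). Each player has 3 marbles, may move 1–3 contiguous marbles, a strictly longer
line pushes a shorter opposing line, and a player wins by ejecting one opposing
marble. -/

def ca : Cell := (-1, 2)
def cb : Cell := (-1, 1)
def cc : Cell := (-1, 0)
def cd : Cell := (0, 2)
def ce : Cell := (0, 1)
def cf : Cell := (0, 0)
def cg : Cell := (0, -1)
def ch : Cell := (1, 1)
def ci : Cell := (1, 0)
def cj : Cell := (1, -1)

def board223 : Finset Cell := {ca, cb, cc, cd, ce, cf, cg, ch, ci, cj}

/-- 2×2×3 Abalone as a game: moves of 1–3 contiguous marbles, win by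
reducing the opponent to fewer than 3 marbles. -/
def G223 : AGame Pos :=
  { move := Move board223 3
    win := Wins board223 3 }

/-- The constellation with black marbles on `b1, b2, b3` and gray marbles
on `g1, g2, g3`. -/
def mk3 (b1 b2 b3 g1 g2 g3 : Cell) : Pos := fun y =>
  if y = b1 ∨ y = b2 ∨ y = b3 then some true
  else if y = g1 ∨ y = g2 ∨ y = g3 then some false
  else none

/-- The boards `C0`–`C8` of the paper (Figure 8). -/
def C0 : Pos := mk3 cc cg cj ca cd ch
def C1 : Pos := mk3 cc cf cg ca cd ch
def C2 : Pos := mk3 cc cf cg ca cd ce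
def C3 : Pos := mk3 cc cf cg ce cd ch
def C4 : Pos := mk3 cb cf cg ca cd ce
def C5 : Pos := mk3 cc cb cg ca cd ce
def C6 : Pos := mk3 cb cf cg ce cd ci
def C7 : Pos := mk3 cb cc cg ci cd ce
def C8 : Pos := mk3 cc cf cg ci cd ce

/-- A valid 2×2×3 constellation: all marbles on the board,
3 black and 3 gray marbles. -/
def Valid223 (c : Pos) : Prop :=
  (∀ y, y ∉ board223 → c y = none) ∧
  countM board223 true c = 3 ∧ countM board223 false c = 3

/-- `c` contains (up to the symmetries of the board) the neutral subconfiguration: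
two Gray marbles in a corner column pair threaten an adjacent Black marble in the
same column (e.g. Gray on `a` and `b` threatening Black on `c`). -/
def ContainsNeutral (c : Pos) : Prop :=
  (c ca = some false ∧ c cb = some false ∧ c cc = some true) ∨
  (c cb = some false ∧ c cc = some false ∧ c ca = some true) ∨
  (c ch = some false ∧ c ci = some false ∧ c cj = some true) ∨
  (c ci = some false ∧ c cj = some false ∧ c ch = some true)

end Abalone

namespace Abalone

/-! ### A computable model of the 2×2×3 board

A constellation is encoded by the list of the contents of the ten cells `a, …, j`. The index `10`
stands for every cell off the board. -/

/-- The cells of the board, in alphabetical order. -/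
def cells : List Cell := [ca, cb, cc, cd, ce, cf, cg, ch, ci, cj]

/-- A list of cell contents. -/
abbrev Code : Type := List (Option Bool)

/-- The content of the cell with index `i`. -/
def look (p : Code) (i : ℕ) : Option Bool := p.getD i none

/-- The constellation encoded by a list of cell contents. -/
def decode (p : Code) : Pos := fun y => look p (cells.idxOf y)

/-- The list of cell contents of a constellation. -/
def encode (c : Pos) : Code := cells.map c

/-- The neighbours of the ten cells in each of the six directions. -/
def neighbours : List (List ℕ) :=
  [[3, 4, 5, 10, 7, 8, 9, 10, 10, 10], [10, 0, 1, 10, 3, 4, 5, 10, 7, 8],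
    [10, 10, 10, 10, 0, 1, 2, 3, 4, 5], [10, 10, 10, 0, 1, 2, 10, 4, 5, 6],
    [1, 2, 10, 4, 5, 6, 10, 8, 9, 10], [4, 5, 6, 7, 8, 9, 10, 10, 10, 10]]

/-- The index of the cell `n` steps from the cell with index `i`, in the direction with index `d`. -/
def walk (d i : ℕ) : ℕ → ℕ
  | 0 => i
  | n + 1 => ((neighbours.getD d []).getD (walk d i n) 10)

/-- Does the content of a cell consist of a marble of player `pl`? -/
def holds (pl : Bool) : Option Bool → Bool
  | none => false
  | some true => pl
  | some false => !pl

/-- Decides `InlineLegal` on encoded constellations. -/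
def inlineLegal (pl : Bool) (p : Code) (x d k m : ℕ) : Bool :=
  (List.range k).all (fun i => holds pl (look p (walk d x i))) &&
    ((List.range m).all (fun i => holds (!pl) (look p (walk d x (k + i)))) &&
      ((look p (walk d x (k + m))).isNone && (m != 0 || Nat.blt (walk d x k) 10)))

/-- The result of an in-line move on encoded constellations. -/
def inlineCode (pl : Bool) (p : Code) (x d k m : ℕ) : Code :=
  let q := (p.set x none).set (walk d x k) (some pl)
  if m = 0 then q else q.set (walk d x (k + m)) (some (!pl))

/-- Decides `BroadLegal` on encoded constellations. -/
def broadLegal (pl : Bool) (p : Code) (x d e k : ℕ) : Bool :=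
  (List.range k).all (fun i => holds pl (look p (walk d x i))) &&
    (List.range k).all (fun i =>
      (look p (walk e (walk d x i) 1)).isNone && Nat.blt (walk e (walk d x i) 1) 10)

/-- The result of a broadside move on encoded constellations. -/
def broadCode (pl : Bool) (p : Code) (x d e k : ℕ) : Code :=
  (List.range k).foldl (fun q i => q.set (walk e (walk d x i) 1) (some pl))
    ((List.range k).foldl (fun q i => q.set (walk d x i) none) p)

/-- The directions that are not along the line with direction `d`. -/
def acrossDirs (d : ℕ) : List ℕ := (List.range 6).filter (fun e => (e + 6 - d) % 3 != 0)

/-- The pairs of a line length, at least two, and a shorter length of an opposing line. -/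
def lineLengths : List (ℕ × ℕ) := [(2, 0), (2, 1), (3, 0), (3, 1), (3, 2)]

/-- The constellations that player `pl` can move to. Moves of one marble count as in-line. -/
def moves (pl : Bool) (p : Code) : List Code :=
  (List.range 10).flatMap fun x => if holds pl (look p x) then
    (List.range 6).flatMap fun d =>
      (if inlineLegal pl p x d 1 0 then [inlineCode pl p x d 1 0] else []) ++
      if holds pl (look p (walk d x 1)) then
        ((lineLengths.filter fun l => inlineLegal pl p x d l.1 l.2).map
          fun l => inlineCode pl p x d l.1 l.2) ++
        [2, 3].flatMap fun k =>
          ((acrossDirs d).filter fun e => broadLegal pl p x d e k).map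
            fun e => broadCode pl p x d e k
      else []
    else []

/-- Apply `f` to `p`, with every entry of `p` evaluated beforehand. -/
def force {α : Type*} : Code → (Code → α) → α
  | [], f => f []
  | none :: p, f => force p fun q => f (none :: q)
  | some true :: p, f => force p fun q => f (some true :: q)
  | some false :: p, f => force p fun q => f (some false :: q)

/-- Has player `pl` fewer than three marbles? -/
def beaten (pl : Bool) (p : Code) : Bool := Nat.blt (p.countP (holds pl)) 3

/-- Can Black push a gray marble off the board? -/
def ejects (p : Code) : Bool :=
  (List.range 10).any fun x => holds true (look p x) && (List.range 6).any fun d =>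
    holds true (look p (walk d x 1)) && lineLengths.any fun l =>
      Nat.ble 10 (walk d x (l.1 + l.2)) && (inlineLegal true p x d l.1 l.2 &&
        beaten false (inlineCode true p x d l.1 l.2))

/-- Black, who is to move, wins within `n + 1` moves while keeping both middle cells. -/
def blackWins : ℕ → Code → Bool
  | 0, p => force p fun p => !beaten true p && ejects p
  | n + 1, p => force p fun p => !beaten true p && (ejects p ||
      (moves true p).any fun r => force r fun r =>
        holds true (look r 4) && (holds true (look r 5) &&
          (!beaten true r && (!(moves false r).isEmpty && (moves false r).all (blackWins n)))))

/-- Black wins within `n + 1` moves when Gray is to move. -/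
def blackWinsNext (n : ℕ) (p : Code) : Bool :=
  !beaten true p && (!(moves false p).isEmpty && (moves false p).all (blackWins n))

/-- `ContainsNeutral` for encoded constellations. -/
def neutral (p : Code) : Bool :=
  [(0, 1, 2), (1, 2, 0), (7, 8, 9), (8, 9, 7)].any fun t =>
    holds false (look p t.1) && (holds false (look p t.2.1) && holds true (look p t.2.2))

/-- The lists with `b` black marbles, `g` gray marbles and `n` empty cells. -/
def words : ℕ → ℕ → ℕ → ℕ → List Code
  | 0, _, _, _ => [[]]
  | l + 1, b, g, n =>
    (if b = 0 then [] else (words l (b - 1) g n).map (some true :: ·)) ++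
    ((if g = 0 then [] else (words l b (g - 1) n).map (some false :: ·)) ++
    (if n = 0 then [] else (words l b g (n - 1)).map (none :: ·)))

/-- The claim of the theorem, with the moves of Black bounded. -/
def verdict (p : Code) : Bool :=
  blackWins 3 p && ((neutral p && (moves false p).any (beaten true)) || blackWinsNext 3 p)

lemma holds_iff {pl : Bool} {v : Option Bool} : holds pl v = true ↔ v = some pl := by
  rcases v with _ | _ | _ <;> cases pl <;> simp [holds]

lemma mem_board_iff {y : Cell} : y ∈ board223 ↔ y ∈ cells := by
  simp [board223, cells]

lemma idxOf_lt_iff {y : Cell} : cells.idxOf y < 10 ↔ y ∈ board223 := by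
  rw [mem_board_iff, ← List.idxOf_lt_length_iff]; rfl

lemma idxOf_inj {y z : Cell} (hy : y ∈ board223) : cells.idxOf y = cells.idxOf z ↔ y = z :=
  List.idxOf_inj (mem_board_iff.1 hy)

lemma walk_idxOf {y d : Cell} {n : ℕ} (hy : y ∈ board223) (hd : d ∈ dirs) (hn : n < 6) :
    walk (dirs.idxOf d) (cells.idxOf y) n = cells.idxOf (stepc y n d) := by
  have key : ∀ y ∈ cells, ∀ d ∈ dirs, ∀ n < 6,
      walk (dirs.idxOf d) (cells.idxOf y) n = cells.idxOf (stepc y n d) := by decide +kernel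
  exact key y (mem_board_iff.1 hy) d hd n hn

lemma addc_eq_stepc (y d : Cell) : addc y d = stepc y 1 d := by
  simp [addc, stepc]

lemma walk_idxOf_one {y d : Cell} (hy : y ∈ board223) (hd : d ∈ dirs) :
    walk (dirs.idxOf d) (cells.idxOf y) 1 = cells.idxOf (addc y d) := by
  rw [addc_eq_stepc, walk_idxOf hy hd (by norm_num)]

lemma stepc_inj {x d : Cell} (hd : d ∈ dirs) {i j : ℕ} : stepc x i d = stepc x j d ↔ i = j := by
  simp only [dirs, List.mem_cons, List.not_mem_nil, or_false] at hd
  rcases hd with rfl | rfl | rfl | rfl | rfl | rfl <;> simp [stepc]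

lemma stepc_zero (x d : Cell) : stepc x 0 d = x := by
  simp [stepc]

lemma addc_stepc_succ_negd (x d : Cell) (i : ℕ) :
    addc (stepc x (i + 1) d) (negd d) = stepc x i d := by
  simp only [addc, stepc, negd, Nat.cast_add, Nat.cast_one, Prod.mk.injEq]
  constructor <;> ring

lemma look_of_le {p : Code} {i : ℕ} (h : p.length ≤ i) : look p i = none := by
  simp [look, h]

lemma look_set {p : Code} {i j : ℕ} {v : Option Bool} (h : j < p.length) :
    look (p.set i v) j = if i = j then v else look p j := by
  simp only [look, List.getD_eq_getElem?_getD, List.getElem?_set]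
  split_ifs <;> simp_all

lemma decode_of_notMem {p : Code} (hp : p.length = 10) {y : Cell} (hy : y ∉ board223) :
    decode p y = none :=
  look_of_le (by rw [hp]; exact not_lt.1 (mt idxOf_lt_iff.1 hy))

lemma mem_board_of_decode {p : Code} (hp : p.length = 10) {y : Cell} {b : Bool}
    (h : decode p y = some b) : y ∈ board223 := by
  by_contra hy
  simp [decode_of_notMem hp hy] at h

lemma decode_set {p : Code} (hp : p.length = 10) {y : Cell} (hy : y ∈ board223) (z : Cell)
    (v : Option Bool) :
    decode (p.set (cells.idxOf z) v) y = if y = z then v else decode p y := by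
  rw [decode, look_set (by rw [hp]; exact idxOf_lt_iff.2 hy)]
  simp only [eq_comm (a := cells.idxOf z), idxOf_inj hy, decode]

lemma decode_encode {c : Pos} (hc : ∀ y, y ∉ board223 → c y = none) : decode (encode c) = c := by
  funext y
  by_cases hy : y ∈ board223
  · have h := List.idxOf_lt_length_iff.2 (mem_board_iff.1 hy)
    simp [decode, encode, look, List.getElem?_eq_getElem h, List.getElem_idxOf]
  · rw [hc y hy]
    exact decode_of_notMem rfl hy

lemma dirs_getElem {d : ℕ} (hd : d < 6) : ∃ v ∈ dirs, dirs.idxOf v = d := by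
  revert d; decide

lemma cells_getElem {x : ℕ} (hx : x < 10) : ∃ y ∈ board223, cells.idxOf y = x := by
  revert x; decide +kernel

lemma idxOf_dirs_lt {d : Cell} (hd : d ∈ dirs) : dirs.idxOf d < 6 :=
  List.idxOf_lt_length_iff.2 hd

lemma mem_acrossDirs {d e : Cell} (hd : d ∈ dirs) (he : e ∈ dirs) :
    dirs.idxOf e ∈ acrossDirs (dirs.idxOf d) ↔ e ≠ d ∧ e ≠ negd d := by
  have key : ∀ d ∈ dirs, ∀ e ∈ dirs,
      (dirs.idxOf e ∈ acrossDirs (dirs.idxOf d) ↔ e ≠ d ∧ e ≠ negd d) := by decide +kernel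
  exact key d hd e he

/-- The condition under which a line of `k` marbles may move in-line against `m` marbles. -/
def InlineLegal (pl : Bool) (c : Pos) (x d : Cell) (k m : ℕ) : Prop :=
  (∀ i < k, stepc x i d ∈ board223 ∧ c (stepc x i d) = some pl) ∧
  (∀ i, k ≤ i → i < k + m → stepc x i d ∈ board223 ∧ c (stepc x i d) = some (!pl)) ∧
  ((m = 0 ∧ stepc x k d ∈ board223 ∧ c (stepc x k d) = none) ∨
    (1 ≤ m ∧ (stepc x (k + m) d ∉ board223 ∨ c (stepc x (k + m) d) = none)))

section

variable {pl : Bool} {p : Code} {x d e : Cell} {k m : ℕ}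

lemma inlineLegal_iff (hp : p.length = 10) (hx : x ∈ board223) (hd : d ∈ dirs) (hkm : k + m < 6) :
    inlineLegal pl p (cells.idxOf x) (dirs.idxOf d) k m = true ↔
      InlineLegal pl (decode p) x d k m := by
  have hw : ∀ i ≤ k + m, look p (walk (dirs.idxOf d) (cells.idxOf x) i) =
      decode p (stepc x i d) := fun i hi => by rw [walk_idxOf hx hd (by omega), decode]
  have hown : ∀ {b : Bool} {y : Cell}, (y ∈ board223 ∧ decode p y = some b) ↔
      decode p y = some b := and_iff_right_of_imp (mem_board_of_decode hp)
  simp only [inlineLegal, InlineLegal, Bool.and_eq_true, Bool.or_eq_true, List.all_eq_true,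
    List.mem_range, holds_iff, hown, Option.isNone_iff_eq_none, bne_iff_ne, Nat.blt_eq]
  refine and_congr ?_ (and_congr ?_ ?_)
  · exact forall₂_congr fun i hi => by rw [hw i (by omega)]
  · constructor
    · intro h i hi hi'
      obtain ⟨j, rfl⟩ := Nat.exists_eq_add_of_le hi
      rw [← hw _ (by omega)]
      exact h j (by omega)
    · intro h i hi
      rw [hw _ (by omega)]
      exact h _ (by omega) (by omega)
  · rw [hw _ le_rfl, walk_idxOf hx hd (by omega), idxOf_lt_iff]
    rcases Nat.eq_zero_or_pos m with rfl | hm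
    · simp [and_comm]
    · have : stepc x (k + m) d ∉ board223 → decode p (stepc x (k + m) d) = none :=
        decode_of_notMem hp
      simp only [hm.ne', Nat.succ_le_of_lt hm, ne_eq, not_false_eq_true]
      tauto

lemma shiftResult_apply {c : Pos} (hd : d ∈ dirs) (hk : 1 ≤ k) (h : InlineLegal pl c x d k m)
    {y : Cell} (hy : y ∈ board223) :
    shiftResult board223 c x d (k + m) y =
      if m ≠ 0 ∧ y = stepc x (k + m) d then some (!pl)
      else if y = stepc x k d then some pl
      else if y = x then none else c y := by
  obtain ⟨hown, hopp, -⟩ := h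
  have hx : ∀ i, stepc x i d = x ↔ i = 0 := fun i => by
    conv_lhs => rhs; rw [← stepc_zero x d]
    exact stepc_inj hd
  by_cases hline : ∃ i, 1 ≤ i ∧ i ≤ k + m ∧ y = stepc x i d
  · obtain ⟨i, hi, hi', rfl⟩ := id hline
    rw [shiftResult, if_neg (not_not.2 hy), if_pos hline]
    obtain ⟨j, rfl⟩ := Nat.exists_eq_add_of_le' hi
    simp only [hx, stepc_inj hd, addc_stepc_succ_negd]
    rcases lt_trichotomy (j + 1) k with hj | rfl | hj
    · rw [if_neg (by omega), if_neg (by omega), if_neg (by omega), if_neg (by omega),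
        (hown j (by omega)).2, (hown (j + 1) hj).2]
    · rw [if_neg (by omega), if_neg (by omega), if_pos rfl, (hown j (by omega)).2]
    · rw [if_neg (by omega), (hopp j (by omega) (by omega)).2]
      split_ifs <;> first | rfl | omega | exact (hopp (j + 1) (by omega) (by omega)).2.symm
  · have h1 : ¬ (m ≠ 0 ∧ y = stepc x (k + m) d) :=
      fun h => hline ⟨k + m, by omega, le_rfl, h.2⟩
    have h2 : y ≠ stepc x k d := fun h => hline ⟨k, hk, by omega, h⟩
    rw [shiftResult, if_neg (not_not.2 hy), if_neg hline, if_neg h1, if_neg h2]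

lemma length_inlineCode {x d : ℕ} : (inlineCode pl p x d k m).length = p.length := by
  unfold inlineCode; split_ifs <;> simp

lemma decode_inlineCode (hp : p.length = 10) (hx : x ∈ board223) (hd : d ∈ dirs) (hk : 1 ≤ k)
    (hkm : k + m < 6) (h : InlineLegal pl (decode p) x d k m) :
    decode (inlineCode pl p (cells.idxOf x) (dirs.idxOf d) k m) =
      shiftResult board223 (decode p) x d (k + m) := by
  funext y
  by_cases hy : y ∈ board223
  · rw [shiftResult_apply hd hk h hy, inlineCode, walk_idxOf hx hd (by omega),
      walk_idxOf hx hd hkm]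
    by_cases hm : m = 0
    · simp [hm, decode_set, hp, hy]
    · simp [hm, decode_set, hp, hy]
  · rw [decode_of_notMem (length_inlineCode.trans hp) hy, shiftResult, if_pos hy]

lemma length_foldl_set {p : Code} {f : ℕ → ℕ} {v : Option Bool} (l : List ℕ) :
    (l.foldl (fun q i => q.set (f i) v) p).length = p.length := by
  induction l generalizing p with
  | nil => rfl
  | cons a l ih => simp [ih]

lemma look_foldl_set {p : Code} {f : ℕ → ℕ} {v : Option Bool} {l : List ℕ} {j : ℕ}
    (hj : j < p.length) :
    look (l.foldl (fun q i => q.set (f i) v) p) j = if ∃ i ∈ l, f i = j then v else look p j := by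
  induction l generalizing p with
  | nil => simp
  | cons a l ih =>
    rw [List.foldl_cons, ih (by simpa using hj), look_set hj]
    by_cases h1 : ∃ i ∈ l, f i = j <;> by_cases h2 : f a = j <;> simp [h1, h2]

lemma length_broadCode {x d e : ℕ} : (broadCode pl p x d e k).length = p.length := by
  simp only [broadCode, length_foldl_set]

/-- The condition under which a line of `k` marbles may move broadside. -/
def BroadLegal (pl : Bool) (c : Pos) (x d e : Cell) (k : ℕ) : Prop :=
  (∀ i < k, stepc x i d ∈ board223 ∧ c (stepc x i d) = some pl) ∧
  (∀ i < k, addc (stepc x i d) e ∈ board223 ∧ c (addc (stepc x i d) e) = none)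

lemma broadLegal_iff (hp : p.length = 10) (hx : x ∈ board223) (hd : d ∈ dirs) (he : e ∈ dirs)
    (hk : k < 6) :
    broadLegal pl p (cells.idxOf x) (dirs.idxOf d) (dirs.idxOf e) k = true ↔
      BroadLegal pl (decode p) x d e k := by
  have hown : ∀ {b : Bool} {y : Cell}, (y ∈ board223 ∧ decode p y = some b) ↔
      decode p y = some b := and_iff_right_of_imp (mem_board_of_decode hp)
  simp only [broadLegal, BroadLegal, Bool.and_eq_true, List.all_eq_true,
    List.mem_range, holds_iff, hown, Option.isNone_iff_eq_none, Nat.blt_eq]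
  have h1 : (∀ i < k, look p (walk (dirs.idxOf d) (cells.idxOf x) i) = some pl) ↔
      ∀ i < k, decode p (stepc x i d) = some pl :=
    forall₂_congr fun i hi => by rw [walk_idxOf hx hd (by omega), decode]
  rw [h1]
  refine and_congr_right fun h => forall₂_congr fun i hi => ?_
  rw [walk_idxOf hx hd (by omega), walk_idxOf_one (mem_board_of_decode hp (h i hi)) he,
    idxOf_lt_iff, and_comm, decode]

lemma decode_broadCode (hp : p.length = 10) (hx : x ∈ board223) (hd : d ∈ dirs) (he : e ∈ dirs)
    (hk : k < 6) (h : BroadLegal pl (decode p) x d e k) :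
    decode (broadCode pl p (cells.idxOf x) (dirs.idxOf d) (dirs.idxOf e) k) =
      broadResult (decode p) pl x d e k := by
  funext y
  have hline : (∃ i ∈ List.range k, walk (dirs.idxOf d) (cells.idxOf x) i = cells.idxOf y) ↔
      ∃ i < k, y = stepc x i d := by
    simp only [List.mem_range]
    refine exists_congr fun i => and_congr_right fun hi => ?_
    rw [walk_idxOf hx hd (by omega), idxOf_inj (h.1 i hi).1, eq_comm]
  have htarget : (∃ i ∈ List.range k,
      walk (dirs.idxOf e) (walk (dirs.idxOf d) (cells.idxOf x) i) 1 = cells.idxOf y) ↔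
      ∃ i < k, y = addc (stepc x i d) e := by
    simp only [List.mem_range]
    refine exists_congr fun i => and_congr_right fun hi => ?_
    rw [walk_idxOf hx hd (by omega), walk_idxOf_one (h.1 i hi).1 he, idxOf_inj (h.2 i hi).1,
      eq_comm]
  by_cases hy : y ∈ board223
  · have hlt : cells.idxOf y < p.length := hp ▸ idxOf_lt_iff.2 hy
    rw [decode, broadCode, look_foldl_set (by rwa [length_foldl_set]), look_foldl_set hlt]
    simp only [hline, htarget, broadResult]
    by_cases h1 : ∃ i < k, y = stepc x i d
    · have h2 : ¬ ∃ i < k, y = addc (stepc x i d) e := by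
        rintro ⟨j, hj, rfl⟩
        obtain ⟨i, hi, hij⟩ := h1
        have := (h.2 j hj).2
        rw [hij, (h.1 i hi).2] at this
        cases this
      rw [if_neg h2, if_pos h1, if_pos h1]
    · rw [if_neg h1, if_neg h1]
      rfl
  · rw [decode_of_notMem (length_broadCode.trans hp) hy, broadResult, if_neg, if_neg,
      decode_of_notMem hp hy]
    · rintro ⟨i, hi, rfl⟩
      exact hy (h.2 i hi).1
    · rintro ⟨i, hi, rfl⟩
      exact hy (h.1 i hi).1

/-- A broadside move of one marble is an in-line move. -/
lemma broadLegal_one_iff {c : Pos} : BroadLegal pl c x d e 1 ↔ InlineLegal pl c x e 1 0 := by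
  simp only [BroadLegal, InlineLegal, Nat.lt_one_iff, forall_eq, stepc_zero, addc_eq_stepc]
  constructor
  · rintro ⟨h1, h2⟩
    exact ⟨h1, fun i hi hi' => by omega, Or.inl ⟨trivial, h2⟩⟩
  · rintro ⟨h1, -, ⟨-, h2⟩ | ⟨h2, -⟩⟩
    · exact ⟨h1, h2⟩
    · omega

lemma inlineCode_one_eq_broadCode {x d e : ℕ} :
    inlineCode pl p x e 1 0 = broadCode pl p x d e 1 := rfl

end

section

variable {pl : Bool} {p q : Code}

lemma mem_moves_iff : q ∈ moves pl p ↔ ∃ x < 10, holds pl (look p x) = true ∧ ∃ d < 6,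
    (inlineLegal pl p x d 1 0 = true ∧ q = inlineCode pl p x d 1 0) ∨
    (holds pl (look p (walk d x 1)) = true ∧
      ((∃ l ∈ lineLengths, inlineLegal pl p x d l.1 l.2 = true ∧
        q = inlineCode pl p x d l.1 l.2) ∨
      ∃ k ∈ [2, 3], ∃ e ∈ acrossDirs d, broadLegal pl p x d e k = true ∧
        q = broadCode pl p x d e k)) := by
  simp only [moves, List.mem_flatMap, List.mem_range, List.mem_ite_nil_right, List.mem_append,
    List.mem_map, List.mem_filter, List.mem_singleton, and_assoc, eq_comm (b := q)]

lemma length_of_mem_moves (h : q ∈ moves pl p) : q.length = p.length := by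
  obtain ⟨x, -, -, d, -, ⟨-, rfl⟩ | ⟨-, ⟨l, -, -, rfl⟩ | ⟨k, -, e, -, -, rfl⟩⟩⟩ := mem_moves_iff.1 h
  · exact length_inlineCode
  · exact length_inlineCode
  · exact length_broadCode

lemma inlineCode_mem_moves {x d : Cell} {k m : ℕ} (hp : p.length = 10) (hd : d ∈ dirs)
    (hk : 1 ≤ k) (hk3 : k ≤ 3) (hm : m < k) (h : InlineLegal pl (decode p) x d k m) :
    inlineCode pl p (cells.idxOf x) (dirs.idxOf d) k m ∈ moves pl p := by
  have hx := h.1 0 (by omega)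
  rw [stepc_zero] at hx
  have hl := (inlineLegal_iff hp hx.1 hd (by omega)).2 h
  refine mem_moves_iff.2 ⟨_, idxOf_lt_iff.2 hx.1, holds_iff.2 hx.2, _, idxOf_dirs_lt hd, ?_⟩
  rcases hk.eq_or_lt with rfl | hk2
  · obtain rfl : m = 0 := by omega
    exact Or.inl ⟨hl, rfl⟩
  · refine Or.inr ⟨holds_iff.2 ?_, Or.inl ⟨(k, m), ?_, hl, rfl⟩⟩
    · rw [walk_idxOf hx.1 hd (by omega)]
      exact (h.1 1 hk2).2
    · interval_cases k <;> interval_cases m <;> decide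

lemma exists_mem_moves {c : Pos} (hp : p.length = 10) (h : Move board223 3 pl (decode p) c) :
    ∃ q ∈ moves pl p, decode q = c := by
  rcases h with ⟨x, d, hd, k, m, hk, hk3, hm, h1, h2, h3, rfl⟩ |
    ⟨x, d, e, hd, he, hed, hed', k, hk, hk3, h1, h2, rfl⟩
  · have h : InlineLegal pl (decode p) x d k m := ⟨h1, h2, h3⟩
    refine ⟨_, inlineCode_mem_moves hp hd hk hk3 hm h, decode_inlineCode hp ?_ hd hk (by omega) h⟩
    simpa [stepc_zero] using (h1 0 (by omega)).1
  · have h : BroadLegal pl (decode p) x d e k := ⟨h1, h2⟩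
    have hx := h1 0 (by omega)
    rw [stepc_zero] at hx
    refine ⟨_, ?_, decode_broadCode hp hx.1 hd he (by omega) h⟩
    rcases hk.eq_or_lt with rfl | hk2
    · rw [← inlineCode_one_eq_broadCode]
      exact inlineCode_mem_moves hp he le_rfl hk3 one_pos (broadLegal_one_iff.1 h)
    · refine mem_moves_iff.2 ⟨_, idxOf_lt_iff.2 hx.1, holds_iff.2 hx.2, _, idxOf_dirs_lt hd,
        Or.inr ⟨holds_iff.2 ?_, Or.inr ⟨k, ?_, _, (mem_acrossDirs hd he).2 ⟨hed, hed'⟩,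
          (broadLegal_iff hp hx.1 hd he (by omega)).2 h, rfl⟩⟩⟩
      · rw [walk_idxOf hx.1 hd (by omega)]
        exact (h.1 1 hk2).2
      · simp only [List.mem_cons, List.not_mem_nil, or_false]
        omega

lemma move_decode (hp : p.length = 10) (h : q ∈ moves pl p) :
    Move board223 3 pl (decode p) (decode q) := by
  have inline_move : ∀ {x d k m : ℕ}, x < 10 → d < 6 → 1 ≤ k → k ≤ 3 → m < k →
      inlineLegal pl p x d k m = true →
      Move board223 3 pl (decode p) (decode (inlineCode pl p x d k m)) := by
    intro x d k m hx hd hk hk3 hm hl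
    obtain ⟨x, hx', rfl⟩ := cells_getElem hx
    obtain ⟨d, hd', rfl⟩ := dirs_getElem hd
    have h := (inlineLegal_iff hp hx' hd' (by omega)).1 hl
    exact Or.inl ⟨x, d, hd', k, m, hk, hk3, hm, h.1, h.2.1, h.2.2,
      decode_inlineCode hp hx' hd' hk (by omega) h⟩
  obtain ⟨x, hx, -, d, hd, ⟨hl, rfl⟩ | ⟨-, ⟨⟨k, m⟩, hkm, hl, rfl⟩ | ⟨k, hk, e, he, hl, rfl⟩⟩⟩ :=
    mem_moves_iff.1 h
  · exact inline_move hx hd le_rfl (by norm_num) one_pos hl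
  · have : ∀ l ∈ lineLengths, 1 ≤ l.1 ∧ l.1 ≤ 3 ∧ l.2 < l.1 := by decide
    obtain ⟨h1, h2, h3⟩ := this _ hkm
    exact inline_move hx hd h1 h2 h3 hl
  · have hk' : 1 ≤ k ∧ k ≤ 3 := by
      simp only [List.mem_cons, List.not_mem_nil, or_false] at hk
      omega
    obtain ⟨x, hx', rfl⟩ := cells_getElem hx
    obtain ⟨d, hd', rfl⟩ := dirs_getElem hd
    obtain ⟨e, he', rfl⟩ := dirs_getElem (List.mem_range.1 (List.mem_filter.1 he).1)
    have h := (broadLegal_iff hp hx' hd' he' (by omega)).1 hl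
    obtain ⟨hed, hed'⟩ := (mem_acrossDirs hd' he').1 he
    exact Or.inr ⟨x, d, e, hd', he', hed, hed', k, hk'.1, hk'.2, h.1, h.2,
      decode_broadCode hp hx' hd' he' (by omega) h⟩

lemma countM_eq (c : Pos) : countM board223 pl c = (encode c).countP (holds pl) := by
  have h : board223.filter (fun y => c y = some pl) =
      (cells.filter fun y => c y = some pl).toFinset := by
    ext y
    simp [mem_board_iff]
  have hnd : (cells.filter fun y => c y = some pl).Nodup := List.Nodup.filter _ (by decide +kernel)
  rw [countM, h, List.toFinset_card_of_nodup hnd, encode, List.countP_map,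
    List.countP_eq_length_filter]
  congr 2
  funext y
  rw [Bool.eq_iff_iff]
  simp [holds_iff]

lemma encode_decode (hp : p.length = 10) : encode (decode p) = p := by
  have h : ∀ i < 10, cells.idxOf (cells.getD i 0) = i := by decide +kernel
  refine List.ext_getElem (by simp [encode, hp, cells]) fun i h1 h2 => ?_
  have hi := h i (by omega)
  rw [List.getD_eq_getElem _ _ (by simpa [encode] using h1)] at hi
  simp only [encode, List.getElem_map, decode, hi, look, List.getD_eq_getElem _ _ h2]

lemma wins_decode_iff (hp : p.length = 10) :
    G223.win (!pl) (decode p) ↔ beaten pl p = true := by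
  simp only [G223, Wins, Bool.not_not, countM_eq, encode_decode hp, beaten, Nat.blt_eq]

lemma force_eq {α : Type*} (p : Code) (f : Code → α) : force p f = f p := by
  induction p generalizing f with
  | nil => rfl
  | cons v p ih => rcases v with _ | _ | _ <;> exact ih _

lemma exists_move_of_ejects (h : ejects p = true) :
    ∃ q ∈ moves true p, beaten false q = true := by
  simp only [ejects, List.any_eq_true, List.mem_range, Bool.and_eq_true] at h
  obtain ⟨x, hx, hxp, d, hd, hdp, l, hl, -, hleg, hb⟩ := h
  exact ⟨_, mem_moves_iff.2 ⟨x, hx, hxp, d, hd, Or.inr ⟨hdp, Or.inl ⟨l, hl, hleg, rfl⟩⟩⟩, hb⟩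

open AGame

lemma forces_win_of_beats (hp : p.length = 10) (hq : q ∈ moves pl p)
    (hb : beaten (!pl) q = true) (hn : beaten pl p = false) : G223.FW pl pl (decode p) := by
  refine .self _ _ (mt (wins_decode_iff hp).1 (by simp [hn])) (move_decode hp hq) (.terminal _ _ ?_)
  have hq10 := (length_of_mem_moves hq).trans hp
  simpa using (wins_decode_iff hq10).2 hb

lemma forces_win_next (hp : p.length = 10) (hn : beaten true p = false)
    (hne : (moves false p).isEmpty = false)
    (h : ∀ q ∈ moves false p, G223.FW true true (decode q)) : G223.FW true false (decode p) := by
  refine .opp _ (mt (wins_decode_iff hp).1 (by simp [hn])) ?_ fun c hc => ?_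
  · obtain ⟨q, hq⟩ := List.exists_mem_of_ne_nil _ (List.isEmpty_eq_false_iff.1 hne)
    exact ⟨_, move_decode hp hq⟩
  · obtain ⟨q, hq, rfl⟩ := exists_mem_moves hp hc
    exact h q hq

lemma forces_win_of_blackWins {n : ℕ} (hp : p.length = 10) (h : blackWins n p = true) :
    G223.FW true true (decode p) := by
  induction n generalizing p with
  | zero =>
    simp only [blackWins, force_eq, Bool.and_eq_true, Bool.not_eq_true'] at h
    obtain ⟨q, hq, hb⟩ := exists_move_of_ejects h.2
    exact forces_win_of_beats hp hq hb h.1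
  | succ n ih =>
    simp only [blackWins, force_eq, Bool.and_eq_true, Bool.or_eq_true, Bool.not_eq_true',
      List.any_eq_true, List.all_eq_true] at h
    obtain ⟨hn, h | ⟨r, hr, -, -, hnr, hne, hall⟩⟩ := h
    · obtain ⟨q, hq, hb⟩ := exists_move_of_ejects h
      exact forces_win_of_beats hp hq hb hn
    · have hr10 := (length_of_mem_moves hr).trans hp
      exact .self _ _ (mt (wins_decode_iff hp).1 (by simp [hn])) (move_decode hp hr)
        (forces_win_next hr10 hnr hne fun q hq =>
          ih ((length_of_mem_moves hq).trans hr10) (hall q hq))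

lemma forces_win_of_blackWinsNext {n : ℕ} (hp : p.length = 10) (h : blackWinsNext n p = true) :
    G223.FW true false (decode p) := by
  simp only [blackWinsNext, Bool.and_eq_true, Bool.not_eq_true', List.all_eq_true] at h
  exact forces_win_next hp h.1 h.2.1 fun q hq =>
    forces_win_of_blackWins ((length_of_mem_moves hq).trans hp) (h.2.2 q hq)

lemma containsNeutral_of_neutral (h : neutral p = true) : ContainsNeutral (decode p) := by
  simp only [neutral, List.any_cons, List.any_nil, Bool.or_eq_true, Bool.and_eq_true, holds_iff,
    Bool.false_eq_true, or_false] at h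
  exact h

lemma mem_words (p : Code) : p ∈ words p.length (p.countP (holds true)) (p.countP (holds false))
    (p.countP Option.isNone) := by
  induction p with
  | nil => simp [words]
  | cons v p ih => rcases v with _ | _ | _ <;> simp [words, holds, List.countP_cons, ih]

lemma countP_isNone (p : Code) : p.countP (holds true) + p.countP (holds false) +
    p.countP Option.isNone = p.length := by
  induction p with
  | nil => rfl
  | cons v p ih =>
    rcases v with _ | _ | _ <;> simp only [List.countP_cons, holds, List.length_cons] <;>
      simp <;> omega

lemma verdict_of_middle (hp : p.length = 10) (hb : p.countP (holds true) = 3)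
    (hg : p.countP (holds false) = 3) (he : look p 4 = some true) (hf : look p 5 = some true) :
    verdict p = true := by
  have key : ∀ p ∈ (words 10 3 3 4).filter fun p => holds true (look p 4) && holds true (look p 5),
      verdict p = true := List.all_eq_true.1 (by decide +kernel)
  have hmem := mem_words p
  have hnone := countP_isNone p
  rw [hp, hb, hg] at hmem hnone
  rw [show p.countP Option.isNone = 4 by omega] at hmem
  exact key p (List.mem_filter.2 ⟨hmem, by simp [holds_iff, he, hf]⟩)

end

end Abalone

open Abalone AGame in
/-- in 2×2×3 Abalone, if Black occupies both middle spaces `e` and `f`,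
then either Black has a winning strategy whoever moves first (`o(C) = L`), or the
constellation contains the neutral subconfiguration (Gray marbles on `a` and `b`
threatening a Black marble on `c`, up to symmetry), in which case the next player
to move wins (`o(C) = N`). -/
theorem black_middle_control (c : Pos) (hval : Valid223 c)
    (he : c ce = some true) (hf : c cf = some true) :
    G223.OutL c ∨ (ContainsNeutral c ∧ G223.OutN c) := by
  obtain ⟨hoff, hblack, hgray⟩ := hval
  rw [countM_eq] at hblack hgray
  have hp : (encode c).length = 10 := rfl
  have hc := decode_encode hoff
  generalize encode c = p at *
  subst hc
  have h := verdict_of_middle hp hblack hgray he hf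
  have hn : beaten false p = false := by rw [beaten, hgray]; rfl
  simp only [verdict, Bool.and_eq_true, Bool.or_eq_true, List.any_eq_true] at h
  obtain ⟨hmove, ⟨hneut, q, hq, hb⟩ | hnext⟩ := h
  · exact Or.inr ⟨containsNeutral_of_neutral hneut, forces_win_of_blackWins hp hmove,
      forces_win_of_beats hp hq hb hn⟩
  · exact Or.inl ⟨forces_win_of_blackWins hp hmove, forces_win_of_blackWinsNext hp hnext⟩
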